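/- arXiv:2008.06417 — 6 statements merged into one kernel-verified Lean document; each statement's English description precedes it below -/
import Mathlib

section
/- Let R be a finite commutative ring, let f : R → R be a map, and let X, Y, Z ⊆ R be subsets such that (i) every finite linear combination x₁y₁ + ⋯ + x_jy_j with x₁,…,x_j ∈ X and y₁,…,y_j ∈ Y lies in ker(f) := {x ∈ R : f(x) = 0}, and (ii) f(y + xz) = x·f(z) for all y ∈ ker(f), x ∈ X, z ∈ Z, and (iii) f(z) is a unit of R for every z ∈ Z. Let Enc : Rᵐ → Rⁿ be an R-linear map, let N ≥ 1, b ∈ {1,…,N}, v ∈ {1,…,n}, and let a₁,…,a_N ∈ Rᵐ, e₁,…,e_N ∈ Rⁿ with e_i[v] ∈ Y for all i ≠ b and e_b[v] ∈ Z. Let m₁,…,m_N ∈ X and set r₁ := Σᵢ mᵢaᵢ and r₂ := Σᵢ mᵢ(Enc(aᵢ) + eᵢ). Then r₂ − Enc(r₁) = Σᵢ mᵢeᵢ, and f((r₂ − Enc(r₁))[v]) = m_b·f(e_b[v]); consequently m_b = f((r₂ − Enc(r₁))[v])·f(e_b[v])⁻¹. -/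
/-- Correctness of the code-based PIR framework over a finite commutative ring. -/
theorem pir_framework_correctness {R : Type*} [CommRing R] [Fintype R]
    (f : R → R) (X Y Z : Set R)
    (hXY : ∀ (j : ℕ) (x y : Fin j → R), (∀ i, x i ∈ X) → (∀ i, y i ∈ Y) →
      f (∑ i, x i * y i) = 0)
    (hker : ∀ y x z, f y = 0 → x ∈ X → z ∈ Z → f (y + x * z) = x * f z)
    (hunit : ∀ z ∈ Z, IsUnit (f z))
    {m n N : ℕ} (hN : 1 ≤ N)
    (Enc : (Fin m → R) →ₗ[R] (Fin n → R))
    (b : Fin N) (v : Fin n)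
    (a : Fin N → Fin m → R) (e : Fin N → Fin n → R)
    (he : ∀ i, i ≠ b → e i v ∈ Y) (heb : e b v ∈ Z)
    (msg : Fin N → R) (hmsg : ∀ i, msg i ∈ X)
    (r₁ : Fin m → R) (r₂ : Fin n → R)
    (hr₁ : r₁ = ∑ i, msg i • a i)
    (hr₂ : r₂ = ∑ i, msg i • (Enc (a i) + e i)) :
    r₂ - Enc r₁ = ∑ i, msg i • e i ∧
    f ((r₂ - Enc r₁) v) = msg b * f (e b v) ∧
    msg b = f ((r₂ - Enc r₁) v) * Ring.inverse (f (e b v)) := by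
  obtain ⟨k, rfl⟩ := Nat.exists_eq_add_of_le' hN
  have hsub : r₂ - Enc r₁ = ∑ i, msg i • e i := by
    simp [hr₁, hr₂, smul_add, Finset.sum_add_distrib]
  have hcoord : (r₂ - Enc r₁) v =
      (∑ i : Fin k, msg (b.succAbove i) * e (b.succAbove i) v) + msg b * e b v := by
    rw [hsub, Finset.sum_apply, Fin.sum_univ_succAbove _ b, add_comm]
    simp only [Pi.smul_apply, smul_eq_mul]
  have hf : f ((r₂ - Enc r₁) v) = msg b * f (e b v) := by
    rw [hcoord]
    exact hker _ _ _
      (hXY k _ _ (fun i => hmsg _) (fun i => he _ (Fin.succAbove_ne b i))) (hmsg b) heb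
  refine ⟨hsub, hf, ?_⟩
  rw [hf, Ring.mul_inverse_cancel_right _ _ (hunit _ heb)]
end

section
/- Let 𝔽_q be a finite field, G ∈ 𝔽_q^{k×n}, and I ⊆ {1,…,n} of size k with G_I invertible. Let b ∈ {1,…,N}, v ∈ {1,…,n} \ I, and let A ∈ 𝔽_q^{N×n} be the matrix whose i-th row is aᵢG + eᵢ, where aᵢ ∈ 𝔽_q^k and eᵢ ∈ 𝔽_q^n satisfy (eᵢ)_I = 0 for all i, eᵢ[v] = 0 for all i ≠ b, and e_b[v] ≠ 0. Then the vector e_b[v]·δ_b, a nonzero scalar multiple of the b-th standard basis vector of 𝔽_q^N, belongs to the 𝔽_q-linear span of the columns of A. -/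
open Matrix

/-- In the basic PIR scheme with identity retrieval function, a nonzero scalar
multiple of the `b`-th standard basis vector lies in the column span of the
query matrix `A`, revealing the desired index `b`. -/
theorem basic_pir_insecure {F : Type*} [Field F] [Fintype F]
    {k n N : ℕ} (G : Matrix (Fin k) (Fin n) F)
    (ι : Fin k → Fin n) (hι : Function.Injective ι)
    (hG : IsUnit (G.submatrix (id : Fin k → Fin k) ι))
    (b : Fin N) (v : Fin n) (hv : ∀ j, ι j ≠ v)
    (a : Fin N → Fin k → F) (e : Fin N → Fin n → F)
    (heI : ∀ i j, e i (ι j) = 0)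
    (hev : ∀ i, i ≠ b → e i v = 0) (hebv : e b v ≠ 0)
    (A : Matrix (Fin N) (Fin n) F)
    (hA : ∀ i, A i = Matrix.vecMul (a i) G + e i) :
    e b v • (Pi.single b (1 : F) : Fin N → F) ∈ Submodule.span F (Set.range A.transpose) := by
  set M := G.submatrix (id : Fin k → Fin k) ι
  have hc : M *ᵥ (M⁻¹ *ᵥ fun r => G r v) = fun r => G r v := by
    rw [mulVec_mulVec, mul_nonsing_inv _ ((isUnit_iff_isUnit_det M).mp hG), one_mulVec]
  set c := M⁻¹ *ᵥ fun r => G r v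
  have key : e b v • (Pi.single b (1 : F) : Fin N → F) = Aᵀ v - ∑ j, c j • Aᵀ (ι j) := by
    ext i
    have hAI (j : Fin k) : A i (ι j) = (a i ᵥ* M) j := by
      rw [hA, Pi.add_apply, heI, add_zero]
      rfl
    have hsum : ∑ j, c j * A i (ι j) = (a i ᵥ* G) v := by
      calc ∑ j, c j * A i (ι j) = (a i ᵥ* M) ⬝ᵥ c := by
            simp only [hAI, dotProduct, mul_comm]
        _ = (a i ᵥ* G) v := by
            rw [← dotProduct_mulVec, hc]
            rfl
    simp only [Pi.sub_apply, Finset.sum_apply, Pi.smul_apply, transpose_apply, smul_eq_mul, hsum]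
    rw [hA, Pi.add_apply, add_sub_cancel_left]
    rcases eq_or_ne i b with rfl | h
    · simp
    · simp [h, hev i h]
  rw [key]
  exact sub_mem (Submodule.subset_span ⟨v, rfl⟩)
    (sum_mem fun j _ => Submodule.smul_mem _ _ (Submodule.subset_span ⟨ι j, rfl⟩))
end

section
/- Let 𝔽_q be a finite field and let N > n ≥ 2. The number of matrices A ∈ 𝔽_q^{N×(n-1)} whose column span contains a vector of Hamming weight one is at most N·(q^{n-1} − 1)·q^{N(n-2)}. Equivalently, the probability that a uniformly random matrix A ∈ 𝔽_q^{N×(n-1)} has a Hamming-weight-one vector in its column span is at most N·q^{(n-1)−N}. -/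
open Matrix

/-- For `v ≠ 0`, a matrix `A` with `A *ᵥ v = b` is determined by all but one of its columns. -/
lemma card_mulVec_eq_le {F ι κ : Type*} [Field F] [Fintype F] [Fintype ι] [Fintype κ]
    {v : κ → F} (hv : v ≠ 0) (b : ι → F) :
    Nat.card {A : Matrix ι κ F // A *ᵥ v = b} ≤
      Fintype.card F ^ (Fintype.card ι * (Fintype.card κ - 1)) := by
  classical
  obtain ⟨j, hj⟩ := Function.ne_iff.mp hv
  let f : {A : Matrix ι κ F // A *ᵥ v = b} → (ι → {k : κ // k ≠ j} → F) :=
    fun A i k => A.1 i k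
  have hf : Function.Injective f := by
    rintro ⟨A, hA⟩ ⟨B, hB⟩ h
    have hoff : ∀ i k, k ≠ j → A i k = B i k := fun i k hk =>
      congrFun (congrFun h i) ⟨k, hk⟩
    refine Subtype.ext (Matrix.ext fun i k => ?_)
    by_cases hk : k = j
    · subst hk
      have hAB : ∑ l, A i l * v l = ∑ l, B i l * v l := congrFun (hA.trans hB.symm) i
      rw [← Finset.add_sum_erase _ _ (Finset.mem_univ k),
        ← Finset.add_sum_erase _ _ (Finset.mem_univ k),
        Finset.sum_congr rfl fun l hl => by rw [hoff i l (Finset.ne_of_mem_erase hl)]] at hAB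
      exact mul_right_cancel₀ hj (add_right_cancel hAB)
    · exact hoff i k hk
  calc Nat.card {A : Matrix ι κ F // A *ᵥ v = b}
      ≤ Nat.card (ι → {k : κ // k ≠ j} → F) := Nat.card_le_card_of_injective f hf
    _ = Fintype.card F ^ (Fintype.card ι * (Fintype.card κ - 1)) := by
      simp [Nat.card_eq_fintype_card, Fintype.card_subtype_compl, ← pow_mul, mul_comm]

/-- A weight-one vector in the column span of `A` yields a standard basis vector of the form
`A *ᵥ v` with `v ≠ 0`. -/
lemma exists_mulVec_eq_single {F ι κ : Type*} [Field F] [Fintype κ] [DecidableEq ι]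
    {A : Matrix ι κ F} {x : ι → F} (hx : x ∈ Submodule.span F (Set.range A.transpose))
    (hw : Nat.card {i : ι // x i ≠ 0} = 1) :
    ∃ (i : ι) (v : κ → F), v ≠ 0 ∧ A *ᵥ v = Pi.single i 1 := by
  have hx' : x ∈ LinearMap.range A.mulVecLin := by
    rw [Matrix.range_mulVecLin]
    exact hx
  obtain ⟨w, rfl⟩ := hx'
  rw [Nat.card_eq_one_iff_unique] at hw
  obtain ⟨hsub, ⟨i, hi⟩⟩ := hw
  have hA : A *ᵥ (((A *ᵥ w) i)⁻¹ • w) = Pi.single i 1 := by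
    rw [Matrix.mulVec_smul]
    ext k
    by_cases hk : k = i
    · subst hk
      simpa using inv_mul_cancel₀ hi
    · have h0 : (A *ᵥ w) k = 0 := by
        by_contra h
        exact hk (congrArg Subtype.val (hsub.elim ⟨k, h⟩ ⟨i, hi⟩))
      simp [h0, hk]
  refine ⟨i, _, fun h => ?_, hA⟩
  rw [h, Matrix.mulVec_zero] at hA
  simpa using congrFun hA i

lemma card_exists_weight_one_le {F ι κ : Type*} [Field F] [Fintype F] [Fintype ι] [Fintype κ] :
    Nat.card {A : Matrix ι κ F //
        ∃ x : ι → F, x ∈ Submodule.span F (Set.range A.transpose) ∧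
          Nat.card {i : ι // x i ≠ 0} = 1}
      ≤ Fintype.card ι * (Fintype.card F ^ Fintype.card κ - 1) *
        Fintype.card F ^ (Fintype.card ι * (Fintype.card κ - 1)) := by
  classical
  have key : ∀ A : {A : Matrix ι κ F //
      ∃ x : ι → F, x ∈ Submodule.span F (Set.range A.transpose) ∧
        Nat.card {i : ι // x i ≠ 0} = 1},
      ∃ p : ι × {v : κ → F // v ≠ 0}, A.1 *ᵥ p.2.1 = Pi.single p.1 1 := by
    rintro ⟨A, x, hx, hw⟩
    obtain ⟨i, v, hv, hA⟩ := exists_mulVec_eq_single hx hw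
    exact ⟨⟨i, v, hv⟩, hA⟩
  choose p hp using key
  let f : _ → Σ p : ι × {v : κ → F // v ≠ 0},
      {A : Matrix ι κ F // A *ᵥ p.2.1 = Pi.single p.1 1} :=
    fun A => ⟨p A, A.1, hp A⟩
  have hf : Function.Injective f := fun A B h =>
    Subtype.ext (congrArg (fun s => s.2.1) h)
  refine (Nat.card_le_card_of_injective f hf).trans ?_
  rw [Nat.card_sigma]
  refine (Finset.sum_le_card_nsmul _ _ _ fun p _ => card_mulVec_eq_le p.2.2 _).trans_eq ?_
  simp [Fintype.card_subtype_compl]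

/-- A counting bound: the number of `N × (n-1)` matrices over a finite field
whose column span contains a Hamming-weight-one vector is at most
`N * (q^(n-1) - 1) * q^(N*(n-2))`; equivalently, the probability for a uniform
random matrix is at most `N * q^((n-1) - N)`. -/
theorem weight_one_in_column_span_rare {F : Type*} [Field F] [Fintype F]
    {N n : ℕ} (hn : 2 ≤ n) (hNn : n < N) :
    Nat.card {A : Matrix (Fin N) (Fin (n - 1)) F //
        ∃ x : Fin N → F, x ∈ Submodule.span F (Set.range A.transpose) ∧
          Nat.card {i : Fin N // x i ≠ 0} = 1}
      ≤ N * (Fintype.card F ^ (n - 1) - 1) * Fintype.card F ^ (N * (n - 2)) ∧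
    (Nat.card {A : Matrix (Fin N) (Fin (n - 1)) F //
        ∃ x : Fin N → F, x ∈ Submodule.span F (Set.range A.transpose) ∧
          Nat.card {i : Fin N // x i ≠ 0} = 1} : ℝ)
        / (Fintype.card F : ℝ) ^ (N * (n - 1))
      ≤ N * (Fintype.card F : ℝ) ^ ((n : ℤ) - 1 - N) := by
  have hcount : Nat.card {A : Matrix (Fin N) (Fin (n - 1)) F //
        ∃ x : Fin N → F, x ∈ Submodule.span F (Set.range A.transpose) ∧
          Nat.card {i : Fin N // x i ≠ 0} = 1}
      ≤ N * (Fintype.card F ^ (n - 1) - 1) * Fintype.card F ^ (N * (n - 2)) := by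
    have h := card_exists_weight_one_le (F := F) (ι := Fin N) (κ := Fin (n - 1))
    rwa [Fintype.card_fin, Fintype.card_fin, Nat.sub_sub] at h
  refine ⟨hcount, ?_⟩
  have hq : (0 : ℝ) < Fintype.card F := by exact_mod_cast Fintype.card_pos
  obtain ⟨m, rfl⟩ := Nat.exists_eq_add_of_le' hn
  rw [div_le_iff₀ (by positivity)]
  have hexp : (Fintype.card F : ℝ) ^ (((m + 2 : ℕ) : ℤ) - 1 - N) *
      (Fintype.card F : ℝ) ^ (N * (m + 2 - 1)) =
      (Fintype.card F : ℝ) ^ (m + 2 - 1) * (Fintype.card F : ℝ) ^ (N * (m + 2 - 2)) := by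
    simp only [← zpow_natCast, ← zpow_add₀ hq.ne']
    congr 1
    simp only [Nat.add_sub_cancel, show m + 2 - 1 = m + 1 from rfl]
    push_cast
    ring
  rw [mul_assoc, hexp, ← mul_assoc]
  have hle := hcount.trans (Nat.mul_le_mul_right _ (Nat.mul_le_mul_left N (Nat.sub_le _ 1)))
  exact_mod_cast hle
end

section
/- Let 𝔽_{q^m}/𝔽_q be a degree-m extension of finite fields, V, W be 𝔽_q-subspaces of 𝔽_{q^m} with 𝔽_{q^m} = V ⊕ W, and π : 𝔽_{q^m} → 𝔽_{q^m} the 𝔽_q-linear projection onto V along W. Let G ∈ 𝔽_{q^m}^{k×n}, and I ⊆ {1,…,n} of size k with G_I invertible. Let b ∈ {1,…,N}, v ∈ {1,…,n} \ I, m₁,…,m_N elements of the subfield 𝔽_q ⊆ 𝔽_{q^m}, a₁,…,a_N ∈ 𝔽_{q^m}^k, and e₁,…,e_N ∈ 𝔽_{q^m}^n with (eᵢ)_I = 0 for all i, eᵢ[v] ∈ W for all i ≠ b, and e_b[v] ∈ V with e_b[v] ≠ 0. Set r := Σᵢ mᵢ(aᵢG + eᵢ). Then r − r_I G_I^{-1}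 G = Σᵢ mᵢeᵢ and π((r − r_I G_I^{-1} G)[v]) = m_b·e_b[v], so that m_b = π((r − r_I G_I^{-1} G)[v])·(e_b[v])^{-1}. -/
open Matrix

/-- If `r = c G + x` with `x` vanishing on an information set, then re-encoding the restriction
of `r` to that set and subtracting the result leaves `x`. -/
theorem sub_vecMul_submatrix_inv_mul {R κ ν : Type*} [CommRing R] [Fintype κ] [DecidableEq κ]
    (G : Matrix κ ν R) (ι : κ → ν) (hG : IsUnit (G.submatrix id ι))
    (c : κ → R) (x : ν → R) (hx : ∀ j, x (ι j) = 0) :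
    (vecMul c G + x) - vecMul (fun j => (vecMul c G + x) (ι j)) ((G.submatrix id ι)⁻¹ * G) = x := by
  have hr : (fun j => (vecMul c G + x) (ι j)) = vecMul c (G.submatrix id ι) := by
    ext j
    simp [hx, vecMul, dotProduct]
  rw [hr, ← vecMul_vecMul, vecMul_vecMul c,
    mul_nonsing_inv _ ((isUnit_iff_isUnit_det _).mp hG), vecMul_one, add_sub_cancel_left]

/-- Correctness of the HHWZ PIR scheme in the code-based framework: decoding
the reply and applying the retrieval function `π = Proj_V` recovers the
desired file `m_b`. -/
theorem hhwz_pir_correctness {F K : Type*} [Field F] [Field K]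
    [Fintype F] [Fintype K] [Algebra F K]
    {m : ℕ} (hm : Module.finrank F K = m)
    (V W : Submodule F K) (h : IsCompl V W)
    (π : K →ₗ[F] K) (hπ : π = V.subtype ∘ₗ Submodule.linearProjOfIsCompl V W h)
    {k n N : ℕ} (G : Matrix (Fin k) (Fin n) K)
    (ι : Fin k → Fin n) (hι : Function.Injective ι)
    (hG : IsUnit (G.submatrix (id : Fin k → Fin k) ι))
    (b : Fin N) (v : Fin n) (hv : ∀ j, ι j ≠ v)
    (msg : Fin N → F) (a : Fin N → Fin k → K) (e : Fin N → Fin n → K)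
    (heI : ∀ i j, e i (ι j) = 0)
    (hev : ∀ i, i ≠ b → e i v ∈ W) (hebV : e b v ∈ V) (hebv : e b v ≠ 0)
    (r : Fin n → K)
    (hr : r = ∑ i, algebraMap F K (msg i) • (Matrix.vecMul (a i) G + e i)) :
    r - Matrix.vecMul (fun j => r (ι j)) ((G.submatrix (id : Fin k → Fin k) ι)⁻¹ * G)
        = ∑ i, algebraMap F K (msg i) • e i ∧
    π ((r - Matrix.vecMul (fun j => r (ι j))
          ((G.submatrix (id : Fin k → Fin k) ι)⁻¹ * G)) v)
        = algebraMap F K (msg b) * e b v ∧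
    algebraMap F K (msg b)
      = π ((r - Matrix.vecMul (fun j => r (ι j))
            ((G.submatrix (id : Fin k → Fin k) ι)⁻¹ * G)) v) * (e b v)⁻¹ := by
  have hdec : r - vecMul (fun j => r (ι j)) ((G.submatrix (id : Fin k → Fin k) ι)⁻¹ * G)
      = ∑ i, algebraMap F K (msg i) • e i := by
    have hr' : r = vecMul (∑ i, algebraMap F K (msg i) • a i) G
        + ∑ i, algebraMap F K (msg i) • e i := by
      simp only [hr, smul_add, Finset.sum_add_distrib, sum_vecMul, smul_vecMul]
    rw [hr']
    exact sub_vecMul_submatrix_inv_mul G ι hG _ _ fun j => by simp [Finset.sum_apply, heI]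
  have hπb : π (e b v) = e b v := by
    rw [hπ]
    exact congrArg Subtype.val (Submodule.projectionOnto_apply_left h ⟨e b v, hebV⟩)
  have hπi : ∀ i, i ≠ b → π (e i v) = 0 := fun i hi => by
    rw [hπ]
    exact congrArg Subtype.val (Submodule.projectionOnto_apply_right h ⟨e i v, hev i hi⟩)
  have hproj : π ((∑ i, algebraMap F K (msg i) • e i) v) = algebraMap F K (msg b) * e b v := by
    simp only [Finset.sum_apply, Pi.smul_apply, algebraMap_smul, map_sum, map_smul]
    rw [Finset.sum_eq_single b (fun i _ hi => by rw [hπi i hi, smul_zero]) (by simp), hπb,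
      Algebra.smul_def]
  rw [hdec, hproj]
  exact ⟨rfl, rfl, (mul_inv_cancel_right₀ hebv _).symm⟩
end

section
/- Let 𝔽_{q^m}/𝔽_q be a degree-m extension of finite fields, let V, W be 𝔽_q-subspaces of 𝔽_{q^m} with dim_{𝔽_q} V = s and dim_{𝔽_q} W = m − s, let G ∈ 𝔽_{q^m}^{k×n}, and let I ⊆ {1,…,n} of size k with G_I invertible and v ∈ {1,…,n} \ I. Let B ∈ 𝔽_{q^m}^{M×n} be a matrix whose i-th row is aᵢG + eᵢ, where aᵢ ∈ 𝔽_{q^m}^k and eᵢ ∈ 𝔽_{q^m}^n satisfies (eᵢ)_I = 0 and eᵢ[v] ∈ W. Then rank_{𝔽_q}(B) ≤ mn − s, where rank_{𝔽_q}(B) denotes the dimension over 𝔽_q of the 𝔽_q-linear span of the rows of B, viewing 𝔽_{q^m}^n as an 𝔽_q-vector space. -/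
open Matrix

/-- The preimage of `W` under a surjective linear map has the codimension of `W`. -/
theorem Submodule.finrank_comap_add_of_surjective {F E K : Type*} [Field F]
    [AddCommGroup E] [Module F E] [FiniteDimensional F E]
    [AddCommGroup K] [Module F K] [FiniteDimensional F K]
    (φ : E →ₗ[F] K) (hφ : Function.Surjective φ) (W : Submodule F K) :
    Module.finrank F (W.comap φ) + Module.finrank F K =
      Module.finrank F E + Module.finrank F W := by
  have h := LinearMap.finrank_range_add_finrank_ker (W.mkQ ∘ₗ φ)
  rw [LinearMap.range_eq_top.2 (by simpa using W.mkQ_surjective.comp hφ), finrank_top,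
    LinearMap.ker_comp, Submodule.ker_mkQ] at h
  have hW := W.finrank_quotient_add_finrank
  omega

/-- If the columns `ι` of `G` form an invertible submatrix, then column `v` of `G` is a linear
combination of them, so every codeword's coordinate `v` is determined by its coordinates in `ι`. -/
theorem Matrix.exists_forall_vecMul_apply_eq_dotProduct {R κ ν : Type*} [CommRing R]
    [Fintype κ] [DecidableEq κ] (G : Matrix κ ν R) (ι : κ → ν)
    (hG : IsUnit (G.submatrix id ι)) (v : ν) :
    ∃ c : κ → R, ∀ a : κ → R, (a ᵥ* G) v = (fun j => (a ᵥ* G) (ι j)) ⬝ᵥ c := by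
  refine ⟨(G.submatrix id ι)⁻¹ *ᵥ fun i => G i v, fun a => ?_⟩
  have h : (fun j => (a ᵥ* G) (ι j)) = a ᵥ* G.submatrix id ι := rfl
  rw [h, ← Matrix.dotProduct_mulVec, Matrix.mulVec_mulVec,
    Matrix.mul_nonsing_inv _ ((Matrix.isUnit_iff_isUnit_det _).1 hG), Matrix.one_mulVec]
  rfl

/-- The deleted-row query matrix `A_b` of the HHWZ scheme has `F`-rank at most
`mn - s`. -/
theorem hhwz_deleted_row_rank_bound {F K : Type*} [Field F] [Field K]
    [Fintype F] [Fintype K] [Algebra F K]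
    {m s k n M : ℕ} (hm : Module.finrank F K = m) (hs : s ≤ m)
    (V W : Submodule F K)
    (hV : Module.finrank F V = s) (hW : Module.finrank F W = m - s)
    (G : Matrix (Fin k) (Fin n) K)
    (ι : Fin k → Fin n) (hι : Function.Injective ι)
    (hG : IsUnit (G.submatrix (id : Fin k → Fin k) ι))
    (v : Fin n) (hv : ∀ j, ι j ≠ v)
    (a : Fin M → Fin k → K) (e : Fin M → Fin n → K)
    (heI : ∀ i j, e i (ι j) = 0) (hev : ∀ i, e i v ∈ W)
    (B : Matrix (Fin M) (Fin n) K)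
    (hB : ∀ i, B i = Matrix.vecMul (a i) G + e i) :
    Module.finrank F (Submodule.span F (Set.range B)) ≤ m * n - s := by
  obtain ⟨c, hc⟩ := G.exists_forall_vecMul_apply_eq_dotProduct ι hG v
  let φ : (Fin n → K) →ₗ[F] K :=
    { toFun := fun x => x v - (fun j => x (ι j)) ⬝ᵥ c
      map_add' := fun x y => by
        simp only [dotProduct, Pi.add_apply, add_mul, Finset.sum_add_distrib]
        ring
      map_smul' := fun r x => by
        simp [dotProduct, smul_sub, Finset.smul_sum] }
  have hφ : Function.Surjective φ := fun x => by
    refine ⟨Pi.single v x, ?_⟩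
    simp [φ, dotProduct, Pi.single_eq_of_ne (hv _)]
  have hle : Submodule.span F (Set.range B) ≤ W.comap φ := by
    rw [Submodule.span_le]
    rintro _ ⟨i, rfl⟩
    have h : φ (B i) = e i v := by
      simp only [φ, hB, LinearMap.coe_mk, AddHom.coe_mk, Pi.add_apply, heI, add_zero, ← hc]
      ring
    simpa [h] using hev i
  have hspan := Submodule.finrank_mono hle
  have hcomap := Submodule.finrank_comap_add_of_surjective φ hφ W
  have hE : Module.finrank F (Fin n → K) = m * n := by
    simp [Module.finrank_pi_fintype, hm, mul_comm]
  omega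
end

section
/- Let ℓ ≥ 1, t = 2^{2ℓ}, 1 ≤ N ≤ 2^{ℓ-1}, and b ∈ {1,…,N}. Let m₁,…,m_N be integers with 0 ≤ mᵢ ≤ 2^ℓ − 1, let eᵢ ∈ {−1,1} for all i ≠ b, and let e_b = t. Set s := Σᵢ mᵢeᵢ and s' := Σ_{i≠b} mᵢeᵢ. Then 2|s'| < t, the unique representative of s modulo t lying in the interval (−t/2, t/2] equals s', and consequently s − s' = m_b·t, so that the desired file m_b is recovered as (s − s')/t. -/
/-- A sum of `n` terms bounded by `c` with signs `±1` has absolute value at most `n * c`. -/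
theorem abs_sum_mul_sign_le {ι : Type*} (S : Finset ι) (m e : ι → ℤ) (c : ℤ)
    (hm : ∀ i ∈ S, 0 ≤ m i ∧ m i ≤ c) (he : ∀ i ∈ S, e i = -1 ∨ e i = 1) :
    |∑ i ∈ S, m i * e i| ≤ S.card * c := by
  refine (Finset.abs_sum_le_sum_abs _ _).trans ?_
  rw [← nsmul_eq_mul]
  refine Finset.sum_le_card_nsmul _ _ _ fun i hi => ?_
  obtain ⟨h0, h1⟩ := hm i hi
  rcases he i hi with h | h <;> simpa [h, abs_of_nonneg h0] using h1

/-- Two integers congruent modulo `t` agree when both are centered, one of them strictly. -/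
theorem eq_of_emod_eq_of_centered {t x r : ℤ} (hx : 2 * |x| < t) (h : r % t = x % t)
    (hr : -t < 2 * r) (hr' : 2 * r ≤ t) : r = x := by
  have hdvd : t ∣ r - x := Int.ModEq.dvd (Int.ModEq.symm h)
  have hlo := neg_abs_le x
  have hhi := le_abs_self x
  have hlt : |r - x| < t := abs_lt.2 ⟨by linarith, by linarith⟩
  exact sub_eq_zero.1 (Int.eq_zero_of_abs_lt_dvd hdvd hlt)


/-- Reply extraction in the AMG PIR scheme: the centered residue of
`s = Σ mᵢeᵢ` modulo `t` is `s' = Σ_{i≠b} mᵢeᵢ`, and `(s - s')/t` recovers the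
desired file `m_b`. -/
theorem amg_reply_extraction {ℓ N : ℕ}
    (hℓ : 1 ≤ ℓ) (hN1 : 1 ≤ N) (hN : N ≤ 2 ^ (ℓ - 1))
    (t : ℤ) (ht : t = 2 ^ (2 * ℓ)) (b : Fin N)
    (msg : Fin N → ℤ) (hmsg : ∀ i, 0 ≤ msg i ∧ msg i ≤ 2 ^ ℓ - 1)
    (e : Fin N → ℤ) (he : ∀ i, i ≠ b → e i = -1 ∨ e i = 1) (heb : e b = t)
    (s s' : ℤ) (hs : s = ∑ i, msg i * e i)
    (hs' : s' = ∑ i ∈ Finset.univ.erase b, msg i * e i) :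
    2 * |s'| < t ∧
    (∀ r : ℤ, r % t = s % t → -t < 2 * r → 2 * r ≤ t → r = s') ∧
    s - s' = msg b * t ∧
    (s - s') / t = msg b := by
  have hpow : (2 : ℤ) ^ ℓ = 2 * 2 ^ (ℓ - 1) := by
    rw [← pow_succ', Nat.sub_add_cancel hℓ]
  have hq : (0 : ℤ) < 2 ^ ℓ := by positivity
  have htq : t = 2 ^ ℓ * 2 ^ ℓ := by rw [ht, two_mul, pow_add]
  have htpos : 0 < t := htq ▸ mul_pos hq hq
  have hNz : (N : ℤ) ≤ 2 ^ (ℓ - 1) := by exact_mod_cast hN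
  have hcard : ((Finset.univ.erase b).card : ℤ) ≤ N := by
    exact_mod_cast (Finset.card_le_univ _).trans_eq (Fintype.card_fin N)
  have habs : |s'| ≤ (Finset.univ.erase b).card * (2 ^ ℓ - 1) := by
    rw [hs']
    exact abs_sum_mul_sign_le _ _ _ _ (fun i _ => hmsg i)
      fun i hi => he i (Finset.ne_of_mem_erase hi)
  have hbound : 2 * |s'| < t := by
    rw [htq]
    nlinarith [mul_le_mul_of_nonneg_right (hcard.trans hNz) (Int.sub_nonneg_of_le hq)]
  have hsplit : s - s' = msg b * t := by
    rw [hs, hs', ← Finset.add_sum_erase _ _ (Finset.mem_univ b), heb, add_sub_cancel_right]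
  refine ⟨hbound, fun r hr h1 h2 => ?_, hsplit, ?_⟩
  · refine eq_of_emod_eq_of_centered hbound (hr.trans ?_) h1 h2
    rw [eq_add_of_sub_eq hsplit, Int.add_comm, Int.add_mul_emod_self_right]
  · rw [hsplit, Int.mul_ediv_cancel _ htpos.ne']
end
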